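/- arXiv:2311.13441 — 3 statements merged into one kernel-verified Lean document; each statement's English description precedes it below -/
import Mathlib

section
/- Let ξ be a locally finite nonnegative-integer-valued Borel measure on ℝ which is infinite in both directions. Then ξ equals the sum of Dirac point masses at its labeled points: ξ = Σ_{n ∈ ℤ} δ_{x_n(ξ)}; equivalently, for every continuous compactly supported f : ℝ → ℝ one has ∫ f dξ = Σ_{n ∈ ℤ} f(x_n(ξ)) (a finite sum). -/
open MeasureTheory Filter Topology Bornology

/-- The labeled points of a locally finite integer-valued measure on `ℝ`:
`x_n(ξ) = inf {x > 0 : ξ(0,x] ≥ n}` for `n > 0` and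
`x_n(ξ) = sup {x ≤ 0 : ξ(x,0] ≥ -n+1}` for `n ≤ 0`. -/
noncomputable def xLabel (μ : MeasureTheory.Measure ℝ) (n : ℤ) : ℝ :=
  if 0 < n then sInf {x : ℝ | 0 < x ∧ (n.toNat : ENNReal) ≤ μ (Set.Ioc 0 x)}
  else sSup {x : ℝ | x ≤ 0 ∧ ((1 - n).toNat : ENNReal) ≤ μ (Set.Ioc x 0)}

/-- A locally finite nonnegative-integer-valued Borel measure on `ℝ`. -/
def IsPointMeasure (μ : MeasureTheory.Measure ℝ) : Prop :=
  ∀ B : Set ℝ, MeasurableSet B → IsBounded B → ∃ m : ℕ, μ B = m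

/-- `μ` is infinite in both directions. -/
def InfiniteBothDirections (μ : MeasureTheory.Measure ℝ) : Prop :=
  μ (Set.Iio 0) = ⊤ ∧ μ (Set.Ioi 0) = ⊤

namespace IsPointMeasure

variable {ξ : Measure ℝ}

lemma measure_lt_top (h : IsPointMeasure ξ) {B : Set ℝ} (hB : MeasurableSet B)
    (hb : IsBounded B) : ξ B < ⊤ := by
  obtain ⟨m, hm⟩ := h B hB hb
  simp [hm]

lemma isFiniteMeasureOnCompacts (h : IsPointMeasure ξ) : IsFiniteMeasureOnCompacts ξ :=
  ⟨fun _ hK => h.measure_lt_top hK.measurableSet hK.isBounded⟩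

/-- The integer-valued distribution function of a point measure, normalized to vanish at `0`. -/
lemma exists_distribution (h : IsPointMeasure ξ) :
    ∃ F : ℝ → ℤ, F 0 = 0 ∧ Monotone F ∧
      ∀ a b, a ≤ b → ξ (Set.Ioc a b) = ((F b - F a).toNat : ENNReal) := by
  choose m hm using fun a b : ℝ => h (Set.Ioc a b) measurableSet_Ioc (Metric.isBounded_Ioc a b)
  have hempty : ∀ a b, b ≤ a → m a b = 0 := fun a b hab => by
    have := hm a b
    rw [Set.Ioc_eq_empty hab.not_gt, measure_empty] at this
    exact_mod_cast this.symm
  have hadd : ∀ a b c, a ≤ b → b ≤ c → m a c = m a b + m b c := fun a b c hab hbc => by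
    have := measure_union (μ := ξ) (Set.Ioc_disjoint_Ioc_of_le (a := a) (d := c) le_rfl)
      (measurableSet_Ioc (a := b))
    rw [Set.Ioc_union_Ioc_eq_Ioc hab hbc, hm, hm, hm] at this
    exact_mod_cast this
  have hsub : ∀ a b, a ≤ b → ((m 0 b : ℤ) - m b 0) - (m 0 a - m a 0) = m a b := by
    intro a b hab
    rcases le_total 0 a with ha | ha
    · have := hadd 0 a b ha hab
      have := hempty a 0 ha
      have := hempty b 0 (ha.trans hab)
      omega
    · rcases le_total 0 b with hb | hb
      · have := hadd a 0 b ha hb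
        have := hempty 0 a ha
        have := hempty b 0 hb
        omega
      · have := hadd a b 0 hab hb
        have := hempty 0 a ha
        have := hempty 0 b hb
        omega
  refine ⟨fun x => (m 0 x : ℤ) - m x 0, by simp, fun a b hab => ?_, fun a b hab => ?_⟩
  · have := hsub a b hab
    dsimp only
    omega
  · rw [hm, hsub a b hab, Int.toNat_natCast]

lemma exists_gt_measure_Ioc_eq_zero (h : IsPointMeasure ξ) (x : ℝ) :
    ∃ y > x, ξ (Set.Ioc x y) = 0 := by
  have hlim : Tendsto (fun y => ξ (Set.Ioc x y)) (𝓝[>] x) (𝓝 0) := by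
    have := tendsto_measure_biInter_gt (μ := ξ) (s := fun y => Set.Ioc x y) (a := x)
      (fun _ _ => measurableSet_Ioc.nullMeasurableSet)
      (fun _ _ _ hij => Set.Ioc_subset_Ioc_right hij)
      ⟨x + 1, by simp, (h.measure_lt_top measurableSet_Ioc (Metric.isBounded_Ioc _ _)).ne⟩
    suffices hinter : ⋂ r > x, Set.Ioc x r = ∅ by rwa [hinter, measure_empty] at this
    refine Set.eq_empty_of_forall_notMem fun z hz => ?_
    simp only [Set.mem_iInter, Set.mem_Ioc] at hz
    have hxz := (hz (x + 1) (by simp)).1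
    linarith [(hz ((x + z) / 2) (show x < (x + z) / 2 by linarith)).2]
  obtain ⟨y, hy, hxy⟩ :=
    ((hlim.eventually (gt_mem_nhds one_pos)).and self_mem_nhdsWithin).exists
  obtain ⟨m, hm⟩ := h _ measurableSet_Ioc (Metric.isBounded_Ioc x y)
  refine ⟨y, hxy, ?_⟩
  rw [hm] at hy ⊢
  have : m < 1 := by exact_mod_cast hy
  simp [Nat.lt_one_iff.mp this]

end IsPointMeasure

namespace InfiniteBothDirections

variable {ξ : Measure ℝ}

lemma exists_le_measure_Ioc_right (h : InfiniteBothDirections ξ) (n : ℕ) :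
    ∃ x > 0, (n : ENNReal) ≤ ξ (Set.Ioc 0 x) := by
  have hmono : Monotone fun k : ℕ => Set.Ioc (0 : ℝ) k :=
    fun i j hij => Set.Ioc_subset_Ioc_right (by exact_mod_cast hij)
  have hlim := tendsto_measure_iUnion_atTop (μ := ξ) hmono
  have hU : ⋃ k : ℕ, Set.Ioc (0 : ℝ) k = Set.Ioi 0 := by
    ext z
    simpa using fun _ => exists_nat_ge z
  rw [hU, h.2] at hlim
  obtain ⟨k, hk, hpos⟩ := ((hlim.eventually (lt_mem_nhds (ENNReal.natCast_lt_top n))).and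
    (eventually_gt_atTop 0)).exists
  exact ⟨k, by exact_mod_cast hpos, hk.le⟩

lemma exists_le_measure_Ioc_left (h : InfiniteBothDirections ξ) (n : ℕ) :
    ∃ x ≤ 0, (n : ENNReal) ≤ ξ (Set.Ioc x 0) := by
  have hmono : Monotone fun k : ℕ => Set.Ioc (-k : ℝ) 0 :=
    fun i j hij => Set.Ioc_subset_Ioc_left (by simpa using hij)
  have hlim := tendsto_measure_iUnion_atTop (μ := ξ) hmono
  have hU : ξ (⋃ k : ℕ, Set.Ioc (-k : ℝ) 0) = ⊤ := by
    refine top_unique (h.1 ▸ measure_mono fun z hz => ?_)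
    obtain ⟨k, hk⟩ := exists_nat_gt (-z)
    exact Set.mem_iUnion.2 ⟨k, by linarith, (Set.mem_Iio.1 hz).le⟩
  rw [hU] at hlim
  obtain ⟨k, hk⟩ := (hlim.eventually (lt_mem_nhds (ENNReal.natCast_lt_top n))).exists
  exact ⟨-k, by simp, hk.le⟩

end InfiniteBothDirections

/-- The labels are the generalized inverse of the distribution function. -/
lemma xLabel_le_iff {ξ : Measure ℝ} (h1 : IsPointMeasure ξ) (h2 : InfiniteBothDirections ξ)
    {F : ℝ → ℤ} (hF0 : F 0 = 0) (hF : Monotone F)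
    (hξ : ∀ a b, a ≤ b → ξ (Set.Ioc a b) = ((F b - F a).toNat : ENNReal)) (n : ℤ) (x : ℝ) :
    xLabel ξ n ≤ x ↔ n ≤ F x := by
  have hright : ∀ x, ∃ y > x, F y = F x := fun x => by
    obtain ⟨y, hxy, hy⟩ := h1.exists_gt_measure_Ioc_eq_zero x
    rw [hξ x y hxy.le, Nat.cast_eq_zero] at hy
    have := hF hxy.le
    exact ⟨y, hxy, by omega⟩
  by_cases hn : 0 < n
  · have hS : {x : ℝ | 0 < x ∧ (n.toNat : ENNReal) ≤ ξ (Set.Ioc 0 x)} =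
        {x : ℝ | 0 < x ∧ n ≤ F x} := by
      ext z
      refine and_congr_right fun hz => ?_
      rw [hξ 0 z hz.le, Nat.cast_le, hF0]
      omega
    obtain ⟨z, hz⟩ : {x : ℝ | 0 < x ∧ n ≤ F x}.Nonempty :=
      hS ▸ h2.exists_le_measure_Ioc_right n.toNat
    rw [xLabel, if_pos hn, hS]
    constructor
    · intro hx
      obtain ⟨y, hxy, hy⟩ := hright x
      obtain ⟨s, hs, hsy⟩ := exists_lt_of_csInf_lt ⟨z, hz⟩ (hx.trans_lt hxy)
      exact hy ▸ hs.2.trans (hF hsy.le)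
    · intro hx
      refine csInf_le ⟨0, fun s hs => hs.1.le⟩ ⟨?_, hx⟩
      by_contra! hx0
      have := hF hx0
      omega
  · have hS : {x : ℝ | x ≤ 0 ∧ ((1 - n).toNat : ENNReal) ≤ ξ (Set.Ioc x 0)} =
        {x : ℝ | x ≤ 0 ∧ F x < n} := by
      ext z
      refine and_congr_right fun hz => ?_
      rw [hξ z 0 hz, Nat.cast_le, hF0]
      omega
    obtain ⟨z, hz⟩ : {x : ℝ | x ≤ 0 ∧ F x < n}.Nonempty :=
      hS ▸ h2.exists_le_measure_Ioc_left (1 - n).toNat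
    rw [xLabel, if_neg hn, hS, ← not_lt, ← not_lt, not_iff_not]
    constructor
    · intro hx
      obtain ⟨s, hs, hsx⟩ := exists_lt_of_lt_csSup ⟨z, hz⟩ hx
      exact (hF hsx.le).trans_lt hs.2
    · intro hx
      obtain ⟨y, hxy, hy⟩ := hright x
      refine hxy.trans_le (le_csSup ⟨0, fun s hs => hs.1⟩ ⟨?_, hy ▸ hx⟩)
      by_contra! hy0
      have := hF hy0.le
      omega

/-- A locally finite nonnegative-integer-valued Borel measure on `ℝ` which is infinite in
both directions equals the sum of Dirac masses at its labeled points; equivalently, for each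
continuous compactly supported `f`, `∫ f dξ = Σ_{n ∈ ℤ} f (x_n(ξ))`, a finite sum. -/
theorem stmt_0 (ξ : MeasureTheory.Measure ℝ)
    (h1 : IsPointMeasure ξ) (h2 : InfiniteBothDirections ξ) :
    ξ = MeasureTheory.Measure.sum (fun n : ℤ => MeasureTheory.Measure.dirac (xLabel ξ n)) ∧
    ∀ f : ℝ → ℝ, Continuous f → HasCompactSupport f →
      (Function.support fun n : ℤ => f (xLabel ξ n)).Finite ∧
      ∫ x, f x ∂ξ = ∑' n : ℤ, f (xLabel ξ n) := by
  obtain ⟨F, hF0, hF, hξ⟩ := h1.exists_distribution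
  have hle := xLabel_le_iff h1 h2 hF0 hF hξ
  have hmem : ∀ a b n, xLabel ξ n ∈ Set.Ioc a b ↔ n ∈ Finset.Ioc (F a) (F b) := fun a b n => by
    simp [← hle, ← not_le]
  have := h1.isFiniteMeasureOnCompacts
  have hsum : ξ = Measure.sum fun n : ℤ => Measure.dirac (xLabel ξ n) := by
    refine Measure.ext_of_Ioc _ _ fun a b hab => ?_
    rw [hξ a b hab.le, Measure.sum_apply _ measurableSet_Ioc,
      tsum_eq_sum (s := Finset.Ioc (F a) (F b)) fun n hn => by
        simp [Measure.dirac_apply', measurableSet_Ioc, hmem, hn],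
      Finset.sum_congr rfl fun n hn =>
        Measure.dirac_apply_of_mem ((hmem a b n).2 hn)]
    simp
  refine ⟨hsum, fun f hf hfc => ⟨?_, ?_⟩⟩
  · obtain ⟨R, hR⟩ := hfc.isCompact.isBounded.subset_closedBall 0
    refine (Finset.finite_toSet (Finset.Ioc (F (-R - 1)) (F R))).subset fun n hn => ?_
    have := hR (subset_tsupport f hn)
    rw [Real.closedBall_eq_Icc] at this
    exact (hmem _ _ n).1 ⟨by linarith [this.1], by linarith [this.2]⟩
  · have hint := hf.integrable_of_hasCompactSupport (μ := ξ) hfc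
    rw [hsum] at hint
    conv_lhs => rw [hsum]
    rw [integral_sum_measure hint]
    simp
end

section
/- Fix n ∈ ℤ. Let ξ, ξ_1, ξ_2, ... be locally finite nonnegative-integer-valued Borel measures on ℝ, each infinite in both directions, and suppose ξ({0}) = 0. If ξ_ℓ converges vaguely to ξ, then x_n(ξ_ℓ) → x_n(ξ) as ℓ → ∞. -/
open MeasureTheory Filter Topology Bornology

theorem IsPointMeasure.isLocallyFiniteMeasure {μ : Measure ℝ} (h : IsPointMeasure μ) :
    IsLocallyFiniteMeasure μ := by
  refine ⟨fun x => ⟨Metric.closedBall x 1, Metric.closedBall_mem_nhds x one_pos, ?_⟩⟩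
  obtain ⟨m, hm⟩ := h (Metric.closedBall x 1) Metric.isClosed_closedBall.measurableSet
    Metric.isBounded_closedBall
  simp [hm]

section Vague

variable {μ : Measure ℝ} {μs : ℕ → Measure ℝ} [IsLocallyFiniteMeasure μ]
  [∀ ℓ, IsLocallyFiniteMeasure (μs ℓ)]

theorem tendsto_lintegral_of_vague
    (hv : ∀ f : ℝ → ℝ, Continuous f → HasCompactSupport f →
      Tendsto (fun ℓ => ∫ x, f x ∂(μs ℓ)) atTop (𝓝 (∫ x, f x ∂μ)))
    {f : ℝ → ℝ} (hf : Continuous f) (hc : HasCompactSupport f) (h0 : ∀ x, 0 ≤ f x) :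
    Tendsto (fun ℓ => ∫⁻ x, ENNReal.ofReal (f x) ∂(μs ℓ)) atTop
      (𝓝 (∫⁻ x, ENNReal.ofReal (f x) ∂μ)) := by
  have key (ν : Measure ℝ) [IsLocallyFiniteMeasure ν] :
      ∫⁻ x, ENNReal.ofReal (f x) ∂ν = ENNReal.ofReal (∫ x, f x ∂ν) :=
    (ofReal_integral_eq_lintegral_ofReal (hf.integrable_of_hasCompactSupport hc)
      (Eventually.of_forall h0)).symm
  simp only [key]
  exact (ENNReal.continuous_ofReal.tendsto _).comp (hv f hf hc)

theorem measure_le_lintegral_ofReal (ν : Measure ℝ) {f : ℝ → ℝ} {K : Set ℝ}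
    (hK : MeasurableSet K) (h1 : Set.EqOn f 1 K) :
    ν K ≤ ∫⁻ x, ENNReal.ofReal (f x) ∂ν := by
  rw [← lintegral_indicator_one hK]
  refine lintegral_mono fun x => ?_
  by_cases hx : x ∈ K
  · simp [hx, h1 hx]
  · simp [hx]

theorem lintegral_ofReal_le_measure (ν : Measure ℝ) {f : ℝ → ℝ} {U : Set ℝ}
    (hU : MeasurableSet U) (h1 : ∀ x, f x ≤ 1) (h0 : Set.EqOn f 0 Uᶜ) :
    ∫⁻ x, ENNReal.ofReal (f x) ∂ν ≤ ν U := by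
  rw [← lintegral_indicator_one hU]
  refine lintegral_mono fun x => ?_
  by_cases hx : x ∈ U
  · simpa [hx] using h1 x
  · simp [hx, h0 hx]

theorem exists_bump {K U : Set ℝ} (hK : IsCompact K) (hU : IsOpen U) (hKU : K ⊆ U) :
    ∃ f : ℝ → ℝ, Continuous f ∧ HasCompactSupport f ∧ (∀ x, 0 ≤ f x) ∧ (∀ x, f x ≤ 1) ∧
      Set.EqOn f 1 K ∧ Set.EqOn f 0 Uᶜ := by
  obtain ⟨f, hf1, hf0, hc, hf⟩ := exists_continuous_one_zero_of_isCompact hK hU.isClosed_compl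
    (Set.disjoint_compl_right_iff_subset.2 hKU)
  exact ⟨f, f.continuous, hc, fun x => (hf x).1, fun x => (hf x).2, hf1, hf0⟩

theorem eventually_lt_measure_of_isOpen
    (hv : ∀ f : ℝ → ℝ, Continuous f → HasCompactSupport f →
      Tendsto (fun ℓ => ∫ x, f x ∂(μs ℓ)) atTop (𝓝 (∫ x, f x ∂μ)))
    {U : Set ℝ} (hU : IsOpen U) {c : ENNReal} (hc : c < μ U) :
    ∀ᶠ ℓ in atTop, c < μs ℓ U := by
  obtain ⟨K, hKU, hK, hcK⟩ := hU.exists_lt_isCompact hc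
  obtain ⟨f, hf, hfc, hf0, hf1, hfK, hfU⟩ := exists_bump hK hU hKU
  filter_upwards [(tendsto_lintegral_of_vague hv hf hfc hf0).eventually_const_lt
    (hcK.trans_le (measure_le_lintegral_ofReal μ hK.measurableSet hfK))] with ℓ hℓ
  exact hℓ.trans_le (lintegral_ofReal_le_measure _ hU.measurableSet hf1 hfU)

theorem eventually_measure_lt_of_isCompact
    (hv : ∀ f : ℝ → ℝ, Continuous f → HasCompactSupport f →
      Tendsto (fun ℓ => ∫ x, f x ∂(μs ℓ)) atTop (𝓝 (∫ x, f x ∂μ)))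
    {K : Set ℝ} (hK : IsCompact K) {c : ENNReal} (hc : μ K < c) :
    ∀ᶠ ℓ in atTop, μs ℓ K < c := by
  obtain ⟨U, hKU, hU, hcU⟩ := K.exists_isOpen_lt_of_lt c hc
  obtain ⟨f, hf, hfc, hf0, hf1, hfK, hfU⟩ := exists_bump hK hU hKU
  filter_upwards [(tendsto_lintegral_of_vague hv hf hfc hf0).eventually_lt_const
    ((lintegral_ofReal_le_measure μ hU.measurableSet hf1 hfU).trans_lt hcU)] with ℓ hℓ
  exact (measure_le_lintegral_ofReal _ hK.measurableSet hfK).trans_lt hℓ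

end Vague

theorem eventually_natCast_le_measure_of_isOpen {μ : Measure ℝ} {μs : ℕ → Measure ℝ}
    [IsLocallyFiniteMeasure μ] (hs : ∀ ℓ, IsPointMeasure (μs ℓ))
    (hv : ∀ f : ℝ → ℝ, Continuous f → HasCompactSupport f →
      Tendsto (fun ℓ => ∫ x, f x ∂(μs ℓ)) atTop (𝓝 (∫ x, f x ∂μ)))
    {U : Set ℝ} (hU : IsOpen U) (hb : IsBounded U) {m : ℕ} (hm : (m : ENNReal) ≤ μ U) :
    ∀ᶠ ℓ in atTop, (m : ENNReal) ≤ μs ℓ U := by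
  have := fun ℓ => (hs ℓ).isLocallyFiniteMeasure
  rcases m with _ | k
  · simp
  have hk : (k : ENNReal) < μ U := lt_of_lt_of_le (by exact_mod_cast k.lt_succ_self) hm
  filter_upwards [eventually_lt_measure_of_isOpen hv hU hk] with ℓ hℓ
  obtain ⟨N, hN⟩ := hs ℓ U hU.measurableSet hb
  rw [hN] at hℓ ⊢
  exact_mod_cast hℓ

theorem exists_natCast_le_measure_Ioc_right {μ : Measure ℝ} (h : μ (Set.Ioi 0) = ⊤) (m : ℕ) :
    ∃ x : ℝ, 0 < x ∧ (m : ENNReal) ≤ μ (Set.Ioc 0 x) := by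
  have hU : ⋃ k : ℕ, Set.Ioc (0 : ℝ) k = Set.Ioi 0 := by
    ext x
    simpa using fun _ => exists_nat_ge x
  have hmono : Monotone fun k : ℕ => Set.Ioc (0 : ℝ) k := fun i j hij =>
    Set.Ioc_subset_Ioc_right (by exact_mod_cast hij)
  have ht := tendsto_measure_iUnion_atTop (μ := μ) hmono
  rw [hU, h] at ht
  obtain ⟨k, hk, hk0⟩ :=
    ((ht.eventually_const_lt (ENNReal.natCast_lt_top m)).and (eventually_gt_atTop 0)).exists
  exact ⟨k, by exact_mod_cast hk0, hk.le⟩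

theorem exists_natCast_le_measure_Ioc_left {μ : Measure ℝ} (h : μ (Set.Iio 0) = ⊤) (m : ℕ) :
    ∃ x : ℝ, x ≤ 0 ∧ (m : ENNReal) ≤ μ (Set.Ioc x 0) := by
  have hU : ⋃ k : ℕ, Set.Ioc (-(k : ℝ)) 0 = Set.Iic 0 := by
    ext x
    simpa [neg_lt] using fun _ => exists_nat_gt (-x)
  have hmono : Monotone fun k : ℕ => Set.Ioc (-(k : ℝ)) 0 := fun i j hij =>
    Set.Ioc_subset_Ioc_left (neg_le_neg (by exact_mod_cast hij))
  have ht := tendsto_measure_iUnion_atTop (μ := μ) hmono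
  rw [hU, measure_mono_top Set.Iio_subset_Iic_self h] at ht
  obtain ⟨k, hk⟩ := (ht.eventually_const_lt (ENNReal.natCast_lt_top m)).exists
  exact ⟨-k, by simp, hk.le⟩

theorem bddBelow_rightLabels (μ : Measure ℝ) (m : ENNReal) :
    BddBelow {x : ℝ | 0 < x ∧ m ≤ μ (Set.Ioc 0 x)} :=
  ⟨0, fun _ hx => hx.1.le⟩

theorem bddAbove_leftLabels (μ : Measure ℝ) (m : ENNReal) :
    BddAbove {x : ℝ | x ≤ 0 ∧ m ≤ μ (Set.Ioc x 0)} :=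
  ⟨0, fun _ hx => hx.1⟩

/-- If locally finite integer-valued measures `ξ_ℓ`, infinite in both directions, converge
vaguely to such a measure `ξ` with `ξ({0}) = 0`, then `x_n(ξ_ℓ) → x_n(ξ)`. -/
theorem stmt_1 (n : ℤ) (ξ : MeasureTheory.Measure ℝ) (ξs : ℕ → MeasureTheory.Measure ℝ)
    (h1 : IsPointMeasure ξ) (h2 : InfiniteBothDirections ξ)
    (h1s : ∀ ℓ, IsPointMeasure (ξs ℓ)) (h2s : ∀ ℓ, InfiniteBothDirections (ξs ℓ))
    (h0 : ξ {0} = 0)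
    (hvague : ∀ f : ℝ → ℝ, Continuous f → HasCompactSupport f →
      Tendsto (fun ℓ => ∫ x, f x ∂(ξs ℓ)) atTop (𝓝 (∫ x, f x ∂ξ))) :
    Tendsto (fun ℓ => xLabel (ξs ℓ) n) atTop (𝓝 (xLabel ξ n)) := by
  have := h1.isLocallyFiniteMeasure
  have := fun ℓ => (h1s ℓ).isLocallyFiniteMeasure
  by_cases hn : 0 < n
  · simp only [xLabel, if_pos hn]
    generalize n.toNat = m
    refine tendsto_order.2 ⟨fun y hy => ?_, fun y hy => ?_⟩
    · obtain ⟨z, hyz, hz⟩ := exists_between hy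
      rcases le_or_gt z 0 with hz0 | hz0
      · refine Eventually.of_forall fun ℓ => (hyz.trans_le hz0).trans_le ?_
        exact Real.sInf_nonneg fun x hx => hx.1.le
      have hlt : ξ (Set.Icc 0 z) < m := by
        rw [← Set.Ioc_insert_left hz0.le]
        refine (measure_union_le {0} (Set.Ioc 0 z)).trans_lt ?_
        rw [h0, zero_add]
        by_contra! hm
        exact (csInf_le (bddBelow_rightLabels ξ m) ⟨hz0, hm⟩).not_gt hz
      filter_upwards [eventually_measure_lt_of_isCompact hvague isCompact_Icc hlt] with ℓ hℓ
      refine hyz.trans_le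
        (le_csInf (exists_natCast_le_measure_Ioc_right (h2s ℓ).2 m) fun x hx => ?_)
      by_contra! hxz
      refine (hx.2.trans (measure_mono ?_)).not_gt hℓ
      exact Set.Ioc_subset_Icc_self.trans (Set.Icc_subset_Icc_right hxz.le)
    · obtain ⟨z, hz, hzy⟩ := exists_between hy
      obtain ⟨x, ⟨hx0, hx⟩, hxz⟩ :=
        exists_lt_of_csInf_lt (exists_natCast_le_measure_Ioc_right h2.2 m) hz
      have hle : (m : ENNReal) ≤ ξ (Set.Ioo 0 z) :=
        hx.trans (measure_mono fun t ht => ⟨ht.1, ht.2.trans_lt hxz⟩)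
      filter_upwards [eventually_natCast_le_measure_of_isOpen h1s hvague isOpen_Ioo
        (Metric.isBounded_Ioo 0 z) hle] with ℓ hℓ
      exact (csInf_le (bddBelow_rightLabels _ _) ⟨hx0.trans hxz,
        hℓ.trans (measure_mono Set.Ioo_subset_Ioc_self)⟩).trans_lt hzy
  · simp only [xLabel, if_neg hn]
    generalize (1 - n).toNat = m
    refine tendsto_order.2 ⟨fun y hy => ?_, fun y hy => ?_⟩
    · obtain ⟨z, hyz, hz⟩ := exists_between hy
      obtain ⟨x, ⟨hx0, hx⟩, hzx⟩ :=
        exists_lt_of_lt_csSup (exists_natCast_le_measure_Ioc_left h2.1 m) hz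
      have hz0 : z < 0 := hzx.trans_le hx0
      have hle : (m : ENNReal) ≤ ξ (Set.Ioo z 0) := by
        refine (hx.trans (measure_mono (Set.Ioc_subset_Ioc_left hzx.le))).trans ?_
        rw [← Set.Ioo_insert_right hz0]
        refine (measure_union_le {0} (Set.Ioo z 0)).trans ?_
        rw [h0, zero_add]
      filter_upwards [eventually_natCast_le_measure_of_isOpen h1s hvague isOpen_Ioo
        (Metric.isBounded_Ioo z 0) hle] with ℓ hℓ
      exact hyz.trans_le (le_csSup (bddAbove_leftLabels _ _) ⟨hz0.le,
        hℓ.trans (measure_mono Set.Ioo_subset_Ioc_self)⟩)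
    · obtain ⟨z, hz, hzy⟩ := exists_between hy
      rcases le_or_gt 0 z with hz0 | hz0
      · refine Eventually.of_forall fun ℓ => lt_of_le_of_lt ?_ (hz0.trans_lt hzy)
        exact Real.sSup_nonpos fun x hx => hx.1
      obtain ⟨w, hw, hwz⟩ := exists_between hz
      have hlt : ξ (Set.Icc z 0) < m := by
        refine (measure_mono (t := Set.Ioc w 0)
          fun t ht => ⟨hwz.trans_le ht.1, ht.2⟩).trans_lt ?_
        by_contra! hm
        exact (le_csSup (bddAbove_leftLabels ξ m) ⟨(hwz.trans hz0).le, hm⟩).not_gt hw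
      filter_upwards [eventually_measure_lt_of_isCompact hvague isCompact_Icc hlt] with ℓ hℓ
      refine lt_of_le_of_lt
        (csSup_le (exists_natCast_le_measure_Ioc_left (h2s ℓ).1 m) fun x hx => ?_) hzy
      by_contra! hzx
      refine (hx.2.trans (measure_mono ?_)).not_gt hℓ
      exact Set.Ioc_subset_Icc_self.trans (Set.Icc_subset_Icc_left hzx.le)
end

section
/- Let ξ, ξ_1, ξ_2, ... be point processes on ℝ, each almost surely infinite in both directions, and suppose that ξ(I) and ξ_ℓ(I) have finite k-th moments for all k ≥ 1, all ℓ, and all compact intervals I. Then the following are equivalent: (i) ξ_ℓ converges in correlation to ξ; (ii) for every continuous compactly supported f : ℝ → ℝ, the random variables ∫ f dξ_ℓ converge in moments to ∫ f dξ, i.e. E[(∫ f dξ_ℓ)^k] → E[(∫ f dξ)^k] for every k ≥ 1. -/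
open MeasureTheory Filter Topology Bornology

open Classical in
/-- The `k`-point correlation sum `C_k(μ, f)`: the sum over tuples of pairwise distinct
indices `(n_1,...,n_k) ∈ ℤ^k` of `f(x_{n_1}(μ),...,x_{n_k}(μ))`. -/
noncomputable def corrSumM (μ : MeasureTheory.Measure ℝ) (k : ℕ) (f : (Fin k → ℝ) → ℝ) : ℝ :=
  ∑' m : Fin k → ℤ, if Function.Injective m then f (fun i => xLabel μ (m i)) else 0

/-- Convergence in correlation of point processes. -/
def ConvInCorr {Ω : Type*} [MeasurableSpace Ω] (P : MeasureTheory.Measure Ω)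
    (ξs : ℕ → Ω → MeasureTheory.Measure ℝ) (ξ : Ω → MeasureTheory.Measure ℝ) : Prop :=
  ∀ k : ℕ, 1 ≤ k → ∀ f : (Fin k → ℝ) → ℝ, Continuous f → HasCompactSupport f →
    Tendsto (fun ℓ => ∫ ω, corrSumM (ξs ℓ ω) k f ∂P) atTop
      (𝓝 (∫ ω, corrSumM (ξ ω) k f ∂P))

/-- Convergence in distribution of point processes, in the sense of linear statistics. -/
def ConvInDist {Ω : Type*} [MeasurableSpace Ω] (P : MeasureTheory.Measure Ω)
    (ξs : ℕ → Ω → MeasureTheory.Measure ℝ) (ξ : Ω → MeasureTheory.Measure ℝ) : Prop :=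
  ∀ f : ℝ → ℝ, Continuous f → HasCompactSupport f →
    ∀ g : BoundedContinuousFunction ℝ ℝ,
    Tendsto (fun ℓ => ∫ ω, g (∫ x, f x ∂(ξs ℓ ω)) ∂P) atTop
      (𝓝 (∫ ω, g (∫ x, f x ∂(ξ ω)) ∂P))

/-- The signed counting function `x ↦ μ (0, x]` (for `0 ≤ x`), `x ↦ -μ (x, 0]` (for `x < 0`). -/
noncomputable def signedCount (μ : Measure ℝ) (x : ℝ) : ℤ :=
  ⌊μ.real (Set.Ioc 0 x)⌋ - ⌊μ.real (Set.Ioc x 0)⌋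

namespace IsPointMeasure

variable {μ : Measure ℝ}

theorem exists_Ioc (h : IsPointMeasure μ) (a b : ℝ) : ∃ m : ℕ, μ (Set.Ioc a b) = m :=
  h _ measurableSet_Ioc (Metric.isBounded_Ioc a b)

theorem measure_Ioc_ne_top (h : IsPointMeasure μ) (a b : ℝ) : μ (Set.Ioc a b) ≠ ⊤ := by
  obtain ⟨m, hm⟩ := h.exists_Ioc a b
  simp [hm]

theorem floor_Ioc (h : IsPointMeasure μ) (a b : ℝ) :
    ((⌊μ.real (Set.Ioc a b)⌋ : ℤ) : ℝ) = μ.real (Set.Ioc a b) := by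
  obtain ⟨m, hm⟩ := h.exists_Ioc a b
  simp [Measure.real, hm]

theorem cast_signedCount (h : IsPointMeasure μ) (x : ℝ) :
    (signedCount μ x : ℝ) = μ.real (Set.Ioc 0 x) - μ.real (Set.Ioc x 0) := by
  simp [signedCount, h.floor_Ioc]

theorem real_Ioc_add (h : IsPointMeasure μ) {a b c : ℝ} (hab : a ≤ b) (hbc : b ≤ c) :
    μ.real (Set.Ioc a b) + μ.real (Set.Ioc b c) = μ.real (Set.Ioc a c) := by
  rw [← Set.Ioc_union_Ioc_eq_Ioc hab hbc, measureReal_union (Set.Ioc_disjoint_Ioc_of_le le_rfl)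
    measurableSet_Ioc (h.measure_Ioc_ne_top _ _) (h.measure_Ioc_ne_top _ _)]

theorem real_Ioc_eq_sub (h : IsPointMeasure μ) {a b : ℝ} (hab : a ≤ b) :
    μ.real (Set.Ioc a b) = signedCount μ b - signedCount μ a := by
  rw [h.cast_signedCount, h.cast_signedCount]
  rcases le_total 0 a with ha | ha
  · have := h.real_Ioc_add ha hab
    simp [Set.Ioc_eq_empty_of_le ha, Set.Ioc_eq_empty_of_le (ha.trans hab)]
    linarith
  rcases le_total 0 b with hb | hb
  · have := h.real_Ioc_add ha hb
    simp [Set.Ioc_eq_empty_of_le ha, Set.Ioc_eq_empty_of_le hb]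
    linarith
  · have := h.real_Ioc_add hab hb
    simp [Set.Ioc_eq_empty_of_le ha, Set.Ioc_eq_empty_of_le hb]
    linarith

theorem monotone_signedCount (h : IsPointMeasure μ) : Monotone (signedCount μ) := by
  intro a b hab
  have h1 := h.real_Ioc_eq_sub hab
  have h2 : (0 : ℝ) ≤ μ.real (Set.Ioc a b) := measureReal_nonneg
  have : (signedCount μ a : ℝ) ≤ signedCount μ b := by linarith
  exact_mod_cast this

theorem signedCount_zero (μ : Measure ℝ) : signedCount μ 0 = 0 := by
  simp [signedCount]

theorem measure_Ioc (h : IsPointMeasure μ) {a b : ℝ} (hab : a ≤ b) :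
    μ (Set.Ioc a b) = ((signedCount μ b - signedCount μ a).toNat : ENNReal) := by
  obtain ⟨m, hm⟩ := h.exists_Ioc a b
  have h1 := h.real_Ioc_eq_sub hab
  rw [Measure.real, hm] at h1
  have h2 : (m : ℤ) = signedCount μ b - signedCount μ a := by
    have h3 : ((m : ℤ) : ℝ) = ((signedCount μ b - signedCount μ a : ℤ) : ℝ) := by
      push_cast
      simpa using h1
    exact_mod_cast h3
  rw [hm, ← h2, Int.toNat_natCast]

theorem exists_gt_signedCount_eq (h : IsPointMeasure μ) (x : ℝ) :
    ∃ y, x < y ∧ signedCount μ y = signedCount μ x := by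
  have hanti : Antitone fun n : ℕ => Set.Ioc x (x + 1 / ((n : ℝ) + 1)) := fun i j hij =>
    Set.Ioc_subset_Ioc_right (by gcongr)
  have hempty : ⋂ n : ℕ, Set.Ioc x (x + 1 / ((n : ℝ) + 1)) = ∅ := by
    rw [Set.eq_empty_iff_forall_notMem]
    intro y hy
    rw [Set.mem_iInter] at hy
    obtain ⟨n, hn⟩ := exists_nat_one_div_lt (sub_pos.2 (hy 0).1)
    linarith [(hy n).2]
  have hlim := tendsto_measure_iInter_atTop (μ := μ)
    (fun n : ℕ => (measurableSet_Ioc (a := x) (b := x + 1 / ((n : ℝ) + 1))).nullMeasurableSet)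
    hanti ⟨0, h.measure_Ioc_ne_top _ _⟩
  rw [hempty, measure_empty] at hlim
  obtain ⟨n, hn⟩ := (hlim.eventually_lt_const (zero_lt_one (α := ENNReal))).exists
  have hpos : x < x + 1 / ((n : ℝ) + 1) := by
    have : 0 < 1 / ((n : ℝ) + 1) := by positivity
    linarith
  refine ⟨_, hpos, ?_⟩
  have hmono := h.monotone_signedCount hpos.le
  rw [Function.comp_apply, h.measure_Ioc hpos.le] at hn
  have h1 : (signedCount μ (x + 1 / ((n : ℝ) + 1)) - signedCount μ x).toNat < 1 := by
    exact_mod_cast hn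
  omega

theorem exists_le_signedCount (h : IsPointMeasure μ) (hinf : InfiniteBothDirections μ) (n : ℤ) :
    ∃ x, n ≤ signedCount μ x := by
  have hunion : ⋃ k : ℕ, Set.Ioc (0 : ℝ) k = Set.Ioi 0 := by
    ext y
    simp only [Set.mem_iUnion, Set.mem_Ioc, Set.mem_Ioi]
    exact ⟨fun ⟨_, hk⟩ => hk.1, fun hy => (exists_nat_ge y).imp fun _ hk => ⟨hy, hk⟩⟩
  have hlim := tendsto_measure_iUnion_atTop (μ := μ) (s := fun k : ℕ => Set.Ioc (0 : ℝ) k)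
    fun i j hij => Set.Ioc_subset_Ioc_right (by gcongr)
  rw [hunion, hinf.2] at hlim
  obtain ⟨k, hk⟩ := (hlim.eventually_const_lt (ENNReal.natCast_lt_top n.toNat)).exists
  refine ⟨k, ?_⟩
  simp only [Function.comp_apply] at hk
  rw [h.measure_Ioc (Nat.cast_nonneg k), signedCount_zero] at hk
  have : n.toNat < (signedCount μ k - 0).toNat := by exact_mod_cast hk
  omega

theorem exists_signedCount_lt (h : IsPointMeasure μ) (hinf : InfiniteBothDirections μ) (n : ℤ) :
    ∃ x, signedCount μ x < n := by
  have hunion : ⋃ k : ℕ, Set.Ioc (-k : ℝ) 0 = Set.Iic 0 := by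
    ext y
    simp only [Set.mem_iUnion, Set.mem_Ioc, Set.mem_Iic]
    exact ⟨fun ⟨_, hk⟩ => hk.2, fun hy => (exists_nat_gt (-y)).imp fun _ hk => ⟨by linarith, hy⟩⟩
  have hlim := tendsto_measure_iUnion_atTop (μ := μ) (s := fun k : ℕ => Set.Ioc (-k : ℝ) 0)
    fun i j hij => Set.Ioc_subset_Ioc_left (by gcongr)
  have htop : μ (Set.Iic 0) = ⊤ := measure_mono_top Set.Iio_subset_Iic_self hinf.1
  rw [hunion, htop] at hlim
  obtain ⟨k, hk⟩ := (hlim.eventually_const_lt (ENNReal.natCast_lt_top (-n).toNat)).exists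
  refine ⟨-k, ?_⟩
  simp only [Function.comp_apply] at hk
  rw [h.measure_Ioc (by simp), signedCount_zero] at hk
  have : (-n).toNat < (0 - signedCount μ (-k)).toNat := by exact_mod_cast hk
  omega

theorem xLabel_of_pos (h : IsPointMeasure μ) {n : ℤ} (hn : 0 < n) :
    xLabel μ n = sInf {x | n ≤ signedCount μ x} := by
  rw [xLabel, if_pos hn]
  congr 1
  ext x
  simp only [Set.mem_ofPred_eq]
  have hmono := h.monotone_signedCount
  have h0 := signedCount_zero μ
  rcases lt_or_ge 0 x with hx | hx
  · rw [h.measure_Ioc hx.le, Nat.cast_le, h0]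
    simp only [hx, true_and]
    omega
  · have := hmono hx
    exact ⟨fun hx' => absurd hx'.1 hx.not_gt, fun hx' => by omega⟩

theorem xLabel_of_nonpos (h : IsPointMeasure μ) {n : ℤ} (hn : n ≤ 0) :
    xLabel μ n = sSup {x | signedCount μ x < n} := by
  rw [xLabel, if_neg hn.not_gt]
  congr 1
  ext x
  simp only [Set.mem_ofPred_eq]
  have hmono := h.monotone_signedCount
  have h0 := signedCount_zero μ
  rcases le_or_gt x 0 with hx | hx
  · rw [h.measure_Ioc hx, Nat.cast_le, h0]
    simp only [hx, true_and]
    omega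
  · have := hmono hx.le
    exact ⟨fun hx' => absurd hx'.1 hx.not_ge, fun hx' => by omega⟩

theorem xLabel_le_iff (h : IsPointMeasure μ) (hinf : InfiniteBothDirections μ) (n : ℤ) (y : ℝ) :
    xLabel μ n ≤ y ↔ n ≤ signedCount μ y := by
  have hmono := h.monotone_signedCount
  have hlt : ∀ {x z}, signedCount μ x < n → n ≤ signedCount μ z → x < z := fun hx hz =>
    hmono.reflect_lt (hx.trans_le hz)
  obtain ⟨u, hu⟩ := h.exists_le_signedCount hinf n
  obtain ⟨l, hl⟩ := h.exists_signedCount_lt hinf n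
  obtain ⟨z, hyz, hz⟩ := h.exists_gt_signedCount_eq y
  rcases lt_or_ge 0 n with hn | hn
  · rw [h.xLabel_of_pos hn]
    refine ⟨fun hle => ?_, fun hle => csInf_le ⟨l, fun x hx => (hlt hl hx).le⟩ hle⟩
    by_contra! hcon
    have : z ≤ sInf {x | n ≤ signedCount μ x} :=
      le_csInf ⟨u, hu⟩ fun x hx => (hlt (hz.trans_lt hcon) hx).le
    linarith
  · rw [h.xLabel_of_nonpos hn]
    refine ⟨fun hle => ?_, fun hle => csSup_le ⟨l, hl⟩ fun x hx => (hlt hx hle).le⟩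
    by_contra! hcon
    have : z ≤ sSup {x | signedCount μ x < n} :=
      le_csSup ⟨u, fun x hx => (hlt hx hu).le⟩ (hz.trans_lt hcon)
    linarith

theorem finite_xLabel_mem_Icc (h : IsPointMeasure μ) (hinf : InfiniteBothDirections μ)
    (a b : ℝ) : {n : ℤ | xLabel μ n ∈ Set.Icc a b}.Finite := by
  refine (Set.finite_Icc (signedCount μ (a - 1)) (signedCount μ b)).subset fun n hn => ?_
  have h1 := (h.xLabel_le_iff hinf n b).1 hn.2
  have h2 := mt (h.xLabel_le_iff hinf n (a - 1)).2 (by linarith [hn.1])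
  exact ⟨by omega, h1⟩

theorem isLocallyFiniteMeasure_s4 (h : IsPointMeasure μ) : IsLocallyFiniteMeasure μ := by
  refine ⟨fun x => ⟨Set.Ioo (x - 1) (x + 1), Ioo_mem_nhds (by simp) (by simp), ?_⟩⟩
  exact (measure_mono Set.Ioo_subset_Ioc_self).trans_lt (h.measure_Ioc_ne_top _ _).lt_top

theorem eq_sum_dirac (h : IsPointMeasure μ) (hinf : InfiniteBothDirections μ) :
    μ = Measure.sum fun n : ℤ => Measure.dirac (xLabel μ n) := by
  have := h.isLocallyFiniteMeasure_s4
  refine Measure.ext_of_Ioc _ _ fun a b hab => ?_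
  rw [Measure.sum_apply _ measurableSet_Ioc]
  have hmem : ∀ n, xLabel μ n ∈ Set.Ioc a b ↔ n ∈ Finset.Ioc (signedCount μ a) (signedCount μ b) := by
    intro n
    rw [Set.mem_Ioc, Finset.mem_Ioc, ← not_le, h.xLabel_le_iff hinf, h.xLabel_le_iff hinf, not_le]
  rw [tsum_eq_sum (s := Finset.Ioc (signedCount μ a) (signedCount μ b)),
    Finset.sum_congr rfl (g := fun _ => 1), h.measure_Ioc hab.le]
  · simp
  · intro n hn
    simp [(hmem n).2 hn]
  · intro n hn
    simp [mt (hmem n).1 hn]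

end IsPointMeasure

/-- The sum of `f (x_{m_1}(μ), ..., x_{m_k}(μ))` over the index tuples `m` in `A`. -/
noncomputable def labelSum (μ : Measure ℝ) {k : ℕ} (A : Set (Fin k → ℤ))
    (f : (Fin k → ℝ) → ℝ) : ℝ :=
  ∑' m, A.indicator (fun m => f (fun i => xLabel μ (m i))) m

theorem corrSumM_eq_labelSum (μ : Measure ℝ) (k : ℕ) (f : (Fin k → ℝ) → ℝ) :
    corrSumM μ k f = labelSum μ {m | Function.Injective m} f := by
  classical
  simp only [corrSumM, labelSum, Set.indicator_apply, Set.mem_ofPred_eq]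

theorem hasCompactSupport_prod {k : ℕ} {g : Fin k → ℝ → ℝ} (hg : ∀ i, HasCompactSupport (g i)) :
    HasCompactSupport fun y : Fin k → ℝ => ∏ i, g i (y i) := by
  refine HasCompactSupport.intro (isCompact_univ_pi fun i => (hg i).isCompact) fun y hy => ?_
  simp only [Set.mem_pi, Set.mem_univ, true_imp_iff, not_forall] at hy
  obtain ⟨i, hi⟩ := hy
  exact Finset.prod_eq_zero (Finset.mem_univ i) (image_eq_zero_of_notMem_tsupport hi)

theorem hasCompactSupport_finsetSum {X ι : Type*} [TopologicalSpace X] [R1Space X] {s : Finset ι}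
    {g : ι → X → ℝ} (hg : ∀ i ∈ s, HasCompactSupport (g i)) :
    HasCompactSupport fun x => ∑ i ∈ s, g i x := by
  refine HasCompactSupport.intro (s.isCompact_biUnion fun i hi => (hg i hi).isCompact) fun x hx => ?_
  simp only [Set.mem_iUnion, not_exists] at hx
  exact Finset.sum_eq_zero fun i hi => image_eq_zero_of_notMem_tsupport (hx i hi)

theorem exists_cutoff {k : ℕ} {f : (Fin k → ℝ) → ℝ} (hf : HasCompactSupport f) :
    ∃ ψ : ℝ → ℝ, Continuous ψ ∧ HasCompactSupport ψ ∧ (∀ x, 0 ≤ ψ x) ∧ (∀ x, ψ x ≤ 1) ∧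
      ∀ y, f y ≠ 0 → ∀ i, ψ (y i) = 1 := by
  have hK : IsCompact (⋃ i : Fin k, (fun y : Fin k → ℝ => y i) '' tsupport f) :=
    isCompact_iUnion fun i => hf.isCompact.image (continuous_apply i)
  obtain ⟨ψ, h1, -, hc, h01⟩ := exists_continuous_one_zero_of_isCompact hK isClosed_empty
    (Set.disjoint_empty _)
  exact ⟨ψ, ψ.continuous, hc, fun x => (h01 x).1, fun x => (h01 x).2, fun y hy i =>
    h1 (Set.mem_iUnion.2 ⟨i, y, subset_tsupport f hy, rfl⟩)⟩

namespace IsPointMeasure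

variable {μ : Measure ℝ} {k : ℕ}

theorem finite_xLabel_ne_zero (h : IsPointMeasure μ) (hinf : InfiniteBothDirections μ)
    {f : ℝ → ℝ} (hf : HasCompactSupport f) : {n : ℤ | f (xLabel μ n) ≠ 0}.Finite := by
  obtain ⟨a, b, hab⟩ := bddBelow_bddAbove_iff_subset_Icc.1
    ⟨hf.isCompact.bddBelow, hf.isCompact.bddAbove⟩
  exact (h.finite_xLabel_mem_Icc hinf a b).subset fun n hn => hab (subset_tsupport f hn)

theorem finite_support_indicator (h : IsPointMeasure μ) (hinf : InfiniteBothDirections μ)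
    (A : Set (Fin k → ℤ)) {f : (Fin k → ℝ) → ℝ} (hf : HasCompactSupport f) :
    (Function.support (A.indicator fun m => f (fun i => xLabel μ (m i)))).Finite := by
  obtain ⟨ψ, -, hψ, -, -, hf1⟩ := exists_cutoff hf
  refine (Set.Finite.pi' fun _ : Fin k => h.finite_xLabel_ne_zero hinf hψ).subset fun m hm i => ?_
  have hm' := Set.mem_of_indicator_ne_zero hm
  rw [Function.mem_support, Set.indicator_of_mem hm'] at hm
  simp [hf1 _ hm i]

theorem summable_indicator (h : IsPointMeasure μ) (hinf : InfiniteBothDirections μ)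
    (A : Set (Fin k → ℤ)) {f : (Fin k → ℝ) → ℝ} (hf : HasCompactSupport f) :
    Summable (A.indicator fun m => f (fun i => xLabel μ (m i))) :=
  summable_of_hasFiniteSupport (h.finite_support_indicator hinf A hf)

theorem labelSum_sub (h : IsPointMeasure μ) (hinf : InfiniteBothDirections μ)
    (A : Set (Fin k → ℤ)) {f g : (Fin k → ℝ) → ℝ} (hf : HasCompactSupport f)
    (hg : HasCompactSupport g) :
    labelSum μ A (fun y => f y - g y) = labelSum μ A f - labelSum μ A g := by
  simp only [labelSum]
  rw [← (h.summable_indicator hinf A hf).tsum_sub (h.summable_indicator hinf A hg)]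
  refine tsum_congr fun m => ?_
  by_cases hm : m ∈ A <;> simp [hm]

theorem labelSum_sum (h : IsPointMeasure μ) (hinf : InfiniteBothDirections μ)
    (A : Set (Fin k → ℤ)) {ι : Type*} (s : Finset ι) {f : ι → (Fin k → ℝ) → ℝ}
    (hf : ∀ j ∈ s, HasCompactSupport (f j)) :
    labelSum μ A (fun y => ∑ j ∈ s, f j y) = ∑ j ∈ s, labelSum μ A (f j) := by
  simp only [labelSum]
  rw [← Summable.tsum_finsetSum fun j hj => h.summable_indicator hinf A (hf j hj)]
  refine tsum_congr fun m => ?_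
  by_cases hm : m ∈ A <;> simp [hm]

theorem abs_labelSum_le (h : IsPointMeasure μ) (hinf : InfiniteBothDirections μ)
    (A : Set (Fin k → ℤ)) {f g : (Fin k → ℝ) → ℝ} (hf : HasCompactSupport f)
    (hg : HasCompactSupport g) (hfg : ∀ y, |f y| ≤ g y) :
    |labelSum μ A f| ≤ labelSum μ Set.univ g := by
  have hf' := (h.summable_indicator hinf A hf).norm
  rw [← Real.norm_eq_abs]
  unfold labelSum
  refine (norm_tsum_le_tsum_norm hf').trans
    (Summable.tsum_le_tsum (fun m => ?_) hf' (h.summable_indicator hinf _ hg))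
  by_cases hm : m ∈ A
  · simpa [hm] using hfg _
  · simpa [hm] using (abs_nonneg _).trans (hfg _)

theorem integrable_of_hasCompactSupport (h : IsPointMeasure μ) {f : ℝ → ℝ} (hf : Continuous f)
    (hfc : HasCompactSupport f) : Integrable f μ :=
  have := h.isLocallyFiniteMeasure_s4
  hf.integrable_of_hasCompactSupport hfc

theorem integral_eq_tsum (h : IsPointMeasure μ) (hinf : InfiniteBothDirections μ) {f : ℝ → ℝ}
    (hf : Continuous f) (hfc : HasCompactSupport f) :
    ∫ x, f x ∂μ = ∑' n : ℤ, f (xLabel μ n) := by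
  have hi := h.integrable_of_hasCompactSupport hf hfc
  have hμ := h.eq_sum_dirac hinf
  have hi' := hi
  rw [hμ] at hi'
  rw [show ∫ x, f x ∂μ = ∫ x, f x ∂(Measure.sum fun n : ℤ => Measure.dirac (xLabel μ n)) by
    rw [← hμ], integral_sum_measure hi']
  simp

theorem labelSum_univ_prod (h : IsPointMeasure μ) (hinf : InfiniteBothDirections μ)
    {f : Fin k → ℝ → ℝ} (hf : ∀ i, Continuous (f i)) (hfc : ∀ i, HasCompactSupport (f i)) :
    labelSum μ Set.univ (fun y => ∏ i, f i (y i)) = ∏ i, ∫ x, f i x ∂μ := by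
  set T : Fin k → Finset ℤ := fun i => (h.finite_xLabel_ne_zero hinf (hfc i)).toFinset with hT
  have hmem : ∀ i n, n ∉ T i → f i (xLabel μ n) = 0 := fun i n hn => by simpa [hT] using hn
  simp only [labelSum, Set.indicator_univ]
  rw [tsum_eq_sum (s := Fintype.piFinset T), 
    ← Finset.prod_univ_sum T fun i n => f i (xLabel μ n)]
  · refine Finset.prod_congr rfl fun i _ => ?_
    rw [h.integral_eq_tsum hinf (hf i) (hfc i), tsum_eq_sum (hmem i)]
  · intro m hm
    simp only [Fintype.mem_piFinset, not_forall] at hm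
    obtain ⟨i, hi⟩ := hm
    exact Finset.prod_eq_zero (Finset.mem_univ i) (hmem i _ hi)

theorem labelSum_univ_pow (h : IsPointMeasure μ) (hinf : InfiniteBothDirections μ)
    {f : ℝ → ℝ} (hf : Continuous f) (hfc : HasCompactSupport f) :
    labelSum μ Set.univ (fun y : Fin k → ℝ => ∏ i, f (y i)) = (∫ x, f x ∂μ) ^ k := by
  simpa using h.labelSum_univ_prod hinf (k := k) (fun _ => hf) (fun _ => hfc)

end IsPointMeasure

/-- A point process that is almost surely infinite in both directions and whose counts in compact
intervals have finite moments of all orders. -/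
structure IsMomentProcess {Ω : Type*} [MeasurableSpace Ω] (P : Measure Ω)
    (η : Ω → Measure ℝ) : Prop where
  measurable : Measurable η
  ae_isPointMeasure : ∀ᵐ ω ∂P, IsPointMeasure (η ω) ∧ InfiniteBothDirections (η ω)
  lintegral_pow_lt_top : ∀ k : ℕ, 1 ≤ k → ∀ a b : ℝ, ∫⁻ ω, (η ω (Set.Icc a b)) ^ k ∂P < ⊤

namespace IsMomentProcess

variable {Ω : Type*} [MeasurableSpace Ω] {P : Measure Ω} {η : Ω → Measure ℝ} {k : ℕ}

theorem aemeasurable_xLabel (hη : IsMomentProcess P η) (n : ℤ) :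
    AEMeasurable (fun ω => xLabel (η ω) n) P := by
  refine NullMeasurable.aemeasurable ?_
  refine measurable_of_Iic (δ := NullMeasurableSpace Ω P) fun y => ?_
  have hset : MeasurableSet {ω | n ≤ signedCount (η ω) y} := by
    have hm : ∀ a b : ℝ, Measurable fun ω => ⌊(η ω).real (Set.Ioc a b)⌋ := fun a b =>
      Int.measurable_floor.comp
        ((Measure.measurable_coe measurableSet_Ioc).comp hη.measurable).ennreal_toReal
    exact measurableSet_le measurable_const ((hm 0 y).sub (hm y 0))
  refine hset.nullMeasurableSet.congr ?_
  filter_upwards [hη.ae_isPointMeasure] with ω hω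
  exact propext (hω.1.xLabel_le_iff hω.2 n y).symm

theorem aestronglyMeasurable_labelSum (hη : IsMomentProcess P η) (A : Set (Fin k → ℤ))
    {f : (Fin k → ℝ) → ℝ} (hf : Continuous f) (hfc : HasCompactSupport f) :
    AEStronglyMeasurable (fun ω => labelSum (η ω) A f) P := by
  refine AEMeasurable.aestronglyMeasurable ?_
  refine aemeasurable_of_tendsto_metrizable_ae (u := atTop) (f := fun (s : Finset (Fin k → ℤ)) ω =>
    ∑ m ∈ s, A.indicator (fun m => f (fun i => xLabel (η ω) (m i))) m) (fun s => ?_) ?_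
  · refine Finset.aemeasurable_fun_sum s fun m _ => ?_
    by_cases hm : m ∈ A
    · simp only [Set.indicator_of_mem hm]
      exact hf.measurable.comp_aemeasurable (aemeasurable_pi_lambda _ fun i =>
        hη.aemeasurable_xLabel (m i))
    · simp only [Set.indicator_of_notMem hm]
      exact aemeasurable_const
  · filter_upwards [hη.ae_isPointMeasure] with ω hω
    exact (hω.1.summable_indicator hω.2 A hfc).hasSum

theorem integrable_cutoff_pow (hη : IsMomentProcess P η) (hk : 1 ≤ k) {ψ : ℝ → ℝ}
    (hψ : Continuous ψ) (hψc : HasCompactSupport ψ) (h0 : ∀ x, 0 ≤ ψ x) (h1 : ∀ x, ψ x ≤ 1) :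
    Integrable (fun ω => labelSum (η ω) Set.univ fun y : Fin k → ℝ => ∏ i, ψ (y i)) P := by
  refine ⟨hη.aestronglyMeasurable_labelSum _ (by fun_prop)
    (hasCompactSupport_prod fun _ => hψc), ?_⟩
  obtain ⟨a, b, hab⟩ := bddBelow_bddAbove_iff_subset_Icc.1
    ⟨hψc.isCompact.bddBelow, hψc.isCompact.bddAbove⟩
  refine lt_of_le_of_lt (lintegral_mono_ae ?_) (hη.lintegral_pow_lt_top k hk a b)
  filter_upwards [hη.ae_isPointMeasure] with ω hω
  rw [hω.1.labelSum_univ_pow hω.2 hψ hψc, enorm_pow]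
  gcongr
  refine (enorm_integral_le_lintegral_enorm _).trans ?_
  rw [← lintegral_indicator_one measurableSet_Icc]
  refine lintegral_mono fun x => ?_
  by_cases hx : x ∈ Set.Icc a b
  · simp only [Set.indicator_of_mem hx, Pi.one_apply]
    rw [Real.enorm_of_nonneg (h0 x)]
    exact ENNReal.ofReal_le_one.2 (h1 x)
  · simp [image_eq_zero_of_notMem_tsupport (mt (@hab x) hx)]

theorem integrable_labelSum (hη : IsMomentProcess P η) (hk : 1 ≤ k) (A : Set (Fin k → ℤ))
    {f : (Fin k → ℝ) → ℝ} (hf : Continuous f) (hfc : HasCompactSupport f) :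
    Integrable (fun ω => labelSum (η ω) A f) P := by
  obtain ⟨ψ, hψ, hψc, h0, h1, hone⟩ := exists_cutoff hfc
  obtain ⟨C, hC⟩ := hfc.exists_bound_of_continuous hf
  have hC0 : 0 ≤ C := (norm_nonneg _).trans (hC 0)
  refine ((hη.integrable_cutoff_pow hk hψ hψc h0 h1).const_mul C).mono'
    (hη.aestronglyMeasurable_labelSum A hf hfc) ?_
  filter_upwards [hη.ae_isPointMeasure] with ω hω
  have hle := hω.1.abs_labelSum_le hω.2 A (g := fun y => C * ∏ i, ψ (y i)) hfc
    (hasCompactSupport_prod fun _ => hψc).mul_left fun y => ?_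
  · refine hle.trans_eq ?_
    simp only [labelSum, Set.indicator_univ]
    exact tsum_mul_left
  · by_cases hy : f y = 0
    · simpa [hy] using mul_nonneg hC0 (Finset.prod_nonneg fun i _ => h0 (y i))
    · simpa [hone y hy] using hC y

end IsMomentProcess

theorem corrSumM_comp_surjective (μ : Measure ℝ) {j k : ℕ} {p : Fin k → Fin j}
    (hp : Function.Surjective p) (f : (Fin k → ℝ) → ℝ) :
    corrSumM μ j (fun y => f fun i => y (p i)) =
      labelSum μ {m : Fin k → ℤ | Setoid.ker m = Setoid.ker p} f := by
  have hinj : Function.Injective fun (m : Fin j → ℤ) (i : Fin k) => m (p i) := fun m m' h =>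
    hp.injective_comp_right h
  rw [corrSumM_eq_labelSum, labelSum, labelSum, ← hinj.tsum_eq]
  · refine tsum_congr fun m => ?_
    have hiff : Function.Injective m ↔ Setoid.ker (fun i => m (p i)) = Setoid.ker p := by
      refine ⟨fun hm => Setoid.ext fun a b => by simp [Setoid.ker_def, hm.eq_iff], fun hm c d h => ?_⟩
      obtain ⟨a, rfl⟩ := hp c
      obtain ⟨b, rfl⟩ := hp d
      exact (Setoid.ext_iff.1 hm a b).1 h
    by_cases hm : Function.Injective m
    · rw [Set.indicator_of_mem (Set.mem_ofPred_eq ▸ hm),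
        Set.indicator_of_mem (Set.mem_ofPred_eq ▸ hiff.1 hm)]
    · rw [Set.indicator_of_notMem (by simpa using hm),
        Set.indicator_of_notMem (by simpa using mt hiff.2 hm)]
  · intro m hm
    have hm' : m ∈ {m : Fin k → ℤ | Setoid.ker m = Setoid.ker p} :=
      Set.mem_of_indicator_ne_zero hm
    rw [Set.mem_ofPred_eq] at hm'
    refine ⟨fun c => m (Function.surjInv hp c), funext fun i => ?_⟩
    exact (Setoid.ext_iff.1 hm' _ _).2 (Function.surjInv_eq hp (p i))

theorem exists_surjective_ker_eq {k : ℕ} (s : Setoid (Fin k)) :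
    ∃ (j : ℕ) (p : Fin k → Fin j), Function.Surjective p ∧ Setoid.ker p = s := by
  classical
  let e := Fintype.equivFin (Quotient s)
  refine ⟨_, fun i => e (Quotient.mk s i), e.surjective.comp Quotient.mk_surjective, ?_⟩
  ext a b
  simp [Setoid.ker_def, Quotient.eq]

instance {k : ℕ} : Finite (Setoid (Fin k)) :=
  Finite.of_injective (fun s : Setoid (Fin k) => fun a b => s a b) fun _ _ h =>
    Setoid.ext fun a b => iff_of_eq (congrFun (congrFun h a) b)

noncomputable instance {k : ℕ} : Fintype (Setoid (Fin k)) := Fintype.ofFinite _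

theorem labelSum_ker_eq_bot (μ : Measure ℝ) {k : ℕ} (f : (Fin k → ℝ) → ℝ) :
    labelSum μ {m : Fin k → ℤ | Setoid.ker m = ⊥} f = corrSumM μ k f := by
  simp only [corrSumM_eq_labelSum, Setoid.injective_iff_ker_bot]

theorem hasCompactSupport_comp_surjective {j k : ℕ} {p : Fin k → Fin j}
    (hp : Function.Surjective p) {f : (Fin k → ℝ) → ℝ} (hf : HasCompactSupport f) :
    HasCompactSupport fun y : Fin j → ℝ => f fun i => y (p i) := by
  have hemb : IsClosedEmbedding (LinearMap.funLeft ℝ ℝ p) :=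
    LinearMap.isClosedEmbedding_of_injective
      (LinearMap.ker_eq_bot.2 (LinearMap.funLeft_injective_of_surjective ℝ ℝ p hp))
  exact hf.comp_isClosedEmbedding hemb

theorem IsPointMeasure.labelSum_univ_eq_sum_ker {μ : Measure ℝ} {k : ℕ} (h : IsPointMeasure μ)
    (hinf : InfiniteBothDirections μ) {f : (Fin k → ℝ) → ℝ} (hf : HasCompactSupport f) :
    labelSum μ Set.univ f =
      ∑ s : Setoid (Fin k), labelSum μ {m : Fin k → ℤ | Setoid.ker m = s} f := by
  classical
  simp only [labelSum]
  rw [← Summable.tsum_finsetSum fun s _ => h.summable_indicator hinf _ hf]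
  refine tsum_congr fun m => ?_
  simp [Set.indicator_apply]

theorem exists_polarization (k : ℕ) : ∃ c : ℝ, c ≠ 0 ∧ ∀ a : Fin k → ℝ,
    c * ∏ i, a i = ∑ B : Finset (Fin k), (-1) ^ B.card * (∑ i ∈ Bᶜ, a i) ^ k := by
  classical
  refine ⟨(Finset.univ.filter fun g : Fin k → Fin k => Function.Surjective g).card, ?_, fun a => ?_⟩
  · rw [Nat.cast_ne_zero]
    exact Finset.card_ne_zero_of_mem (a := id) (by simpa using Function.surjective_id)
  have hpow : ∀ B : Finset (Fin k), (∑ i ∈ Bᶜ, a i) ^ k =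
      ∑ g : Fin k → Fin k, if B ⊆ (Finset.univ.image g)ᶜ then ∏ i, a (g i) else 0 := by
    intro B
    have := Finset.prod_univ_sum (fun _ : Fin k => Bᶜ) fun _ n => a n
    rw [Finset.prod_const, Finset.card_univ, Fintype.card_fin] at this
    rw [this, ← Finset.sum_filter]
    refine Finset.sum_congr (Finset.ext fun g => ?_) fun _ _ => rfl
    simp only [Fintype.mem_piFinset, Finset.mem_filter, Finset.mem_univ, true_and,
      Finset.subset_iff, Finset.mem_compl, Finset.mem_image, not_exists]
    exact ⟨fun h x hx i hi => h i (hi ▸ hx), fun h i hi => h hi i rfl⟩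
  have halt : ∀ g : Fin k → Fin k,
      ∑ B : Finset (Fin k), (if B ⊆ (Finset.univ.image g)ᶜ then (-1 : ℝ) ^ B.card else 0) =
        if Function.Surjective g then 1 else 0 := by
    intro g
    have h1 := Finset.sum_powerset_neg_one_pow_card (x := (Finset.univ.image g)ᶜ)
    have h2 : (Finset.univ.image g)ᶜ = ∅ ↔ Function.Surjective g := by
      simp [Finset.eq_univ_iff_forall, Function.Surjective]
    rw [← Finset.sum_filter]
    have h3 : (Finset.univ.filter fun B => B ⊆ (Finset.univ.image g)ᶜ) =
        ((Finset.univ.image g)ᶜ).powerset := by ext; simp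
    rw [h3]
    simp only [h2] at h1
    exact_mod_cast h1
  simp only [hpow, Finset.mul_sum]
  rw [Finset.sum_comm]
  have : ∀ g : Fin k → Fin k, ∑ B : Finset (Fin k), (-1 : ℝ) ^ B.card *
      (if B ⊆ (Finset.univ.image g)ᶜ then ∏ i, a (g i) else 0) =
        if Function.Surjective g then ∏ i, a i else 0 := by
    intro g
    rw [show (if Function.Surjective g then ∏ i, a i else 0) =
      (if Function.Surjective g then 1 else 0) * ∏ i, a (g i) by
        split_ifs with hg
        · rw [one_mul, (Finite.injective_iff_surjective.2 hg |>.bijective_of_finite).prod_comp]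
        · simp, ← halt g, Finset.sum_mul]
    exact Finset.sum_congr rfl fun B _ => by split_ifs <;> simp
  rw [Finset.sum_congr rfl fun g _ => this g, ← Finset.sum_filter, Finset.sum_const, nsmul_eq_mul]

theorem exists_mvPolynomial_near {k : ℕ} {f : (Fin k → ℝ) → ℝ} (hf : Continuous f)
    {K : Set (Fin k → ℝ)} (hK : IsCompact K) {ε : ℝ} (hε : 0 < ε) :
    ∃ p : MvPolynomial (Fin k) ℝ, ∀ y ∈ K, |f y - MvPolynomial.eval y p| < ε := by
  let X : Fin k → C(Fin k → ℝ, ℝ) := fun i => ⟨fun y => y i, continuous_apply i⟩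
  have hsep : (MvPolynomial.aeval (R := ℝ) X).range.SeparatesPoints := by
    intro y z hyz
    obtain ⟨i, hi⟩ := Function.ne_iff.1 hyz
    exact ⟨_, ⟨X i, ⟨MvPolynomial.X i, by simp⟩, rfl⟩, hi⟩
  obtain ⟨g, ⟨p, rfl⟩, hp⟩ :=
    ContinuousMap.exists_mem_subalgebra_near_continuous_of_isCompact_of_separatesPoints
      hsep ⟨f, hf⟩ hK hε
  have heval : ∀ q y, (MvPolynomial.aeval (R := ℝ) X q) y = MvPolynomial.eval y q := by
    intro q y
    induction q using MvPolynomial.induction_on with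
    | C a => simp
    | add q r hq hr => simp [hq, hr]
    | mul_X q i hq => simp [hq, X]
  refine ⟨p, fun y hy => ?_⟩
  have := hp y hy
  rw [Real.norm_eq_abs, abs_sub_comm] at this
  simpa [heval] using this

/-- Convergence of the expected sums of `f` over the label tuples in `A`. -/
def TendstoLabelSum {Ω : Type*} [MeasurableSpace Ω] (P : Measure Ω)
    (ξs : ℕ → Ω → Measure ℝ) (ξ : Ω → Measure ℝ) {k : ℕ} (A : Set (Fin k → ℤ))
    (f : (Fin k → ℝ) → ℝ) : Prop :=
  Tendsto (fun ℓ => ∫ ω, labelSum (ξs ℓ ω) A f ∂P) atTop (𝓝 (∫ ω, labelSum (ξ ω) A f ∂P))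

namespace IsMomentProcess

variable {Ω : Type*} [MeasurableSpace Ω] {P : Measure Ω} {η : Ω → Measure ℝ} {k : ℕ}

theorem integral_labelSum_univ_pow (hη : IsMomentProcess P η) {f : ℝ → ℝ} (hf : Continuous f)
    (hfc : HasCompactSupport f) :
    ∫ ω, labelSum (η ω) Set.univ (fun y : Fin k → ℝ => ∏ i, f (y i)) ∂P =
      ∫ ω, (∫ x, f x ∂(η ω)) ^ k ∂P :=
  integral_congr_ae <| hη.ae_isPointMeasure.mono fun _ hω =>
    hω.1.labelSum_univ_pow hω.2 hf hfc

theorem integrable_integral_pow (hη : IsMomentProcess P η) (hk : 1 ≤ k) {f : ℝ → ℝ}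
    (hf : Continuous f) (hfc : HasCompactSupport f) :
    Integrable (fun ω => (∫ x, f x ∂(η ω)) ^ k) P := by
  have hint := hη.integrable_labelSum hk Set.univ (f := fun y : Fin k → ℝ => ∏ i, f (y i))
    (by fun_prop) (hasCompactSupport_prod fun _ => hfc)
  refine hint.congr ?_
  filter_upwards [hη.ae_isPointMeasure] with ω hω
  exact hω.1.labelSum_univ_pow hω.2 hf hfc

theorem integral_labelSum_univ_eq_sum_ker (hη : IsMomentProcess P η) (hk : 1 ≤ k)
    {f : (Fin k → ℝ) → ℝ} (hf : Continuous f) (hfc : HasCompactSupport f) :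
    ∫ ω, labelSum (η ω) Set.univ f ∂P = ∑ s : Setoid (Fin k),
      ∫ ω, labelSum (η ω) {m : Fin k → ℤ | Setoid.ker m = s} f ∂P := by
  rw [← integral_finsetSum _ fun s _ => hη.integrable_labelSum hk _ hf hfc]
  exact integral_congr_ae <| hη.ae_isPointMeasure.mono fun _ hω =>
    hω.1.labelSum_univ_eq_sum_ker hω.2 hfc

theorem integral_labelSum_sum (hη : IsMomentProcess P η) (hk : 1 ≤ k) (A : Set (Fin k → ℤ))
    {ι : Type*} (s : Finset ι) {f : ι → (Fin k → ℝ) → ℝ} (hf : ∀ j, Continuous (f j))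
    (hfc : ∀ j, HasCompactSupport (f j)) :
    ∫ ω, labelSum (η ω) A (fun y => ∑ j ∈ s, f j y) ∂P =
      ∑ j ∈ s, ∫ ω, labelSum (η ω) A (f j) ∂P := by
  rw [← integral_finsetSum _ fun j _ => hη.integrable_labelSum hk _ (hf j) (hfc j)]
  exact integral_congr_ae <| hη.ae_isPointMeasure.mono fun _ hω =>
    hω.1.labelSum_sum hω.2 A s fun j _ => hfc j

theorem abs_integral_labelSum_sub_le (hη : IsMomentProcess P η) (hk : 1 ≤ k)
    (A : Set (Fin k → ℤ)) {f g b : (Fin k → ℝ) → ℝ} (hf : Continuous f)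
    (hfc : HasCompactSupport f) (hg : Continuous g) (hgc : HasCompactSupport g)
    (hb : Continuous b) (hbc : HasCompactSupport b) (hle : ∀ y, |f y - g y| ≤ b y) :
    |∫ ω, labelSum (η ω) A f ∂P - ∫ ω, labelSum (η ω) A g ∂P| ≤
      ∫ ω, labelSum (η ω) Set.univ b ∂P := by
  rw [← integral_sub (hη.integrable_labelSum hk _ hf hfc) (hη.integrable_labelSum hk _ hg hgc),
    ← Real.norm_eq_abs]
  refine norm_integral_le_of_norm_le (hη.integrable_labelSum hk _ hb hbc) ?_
  filter_upwards [hη.ae_isPointMeasure] with ω hω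
  rw [← hω.1.labelSum_sub hω.2 A hfc hgc]
  exact hω.1.abs_labelSum_le hω.2 A (hfc.sub hgc) hbc hle

theorem integral_labelSum_univ_prod (hη : IsMomentProcess P η) (hk : 1 ≤ k) {c : ℝ}
    (hc : ∀ a : Fin k → ℝ,
      c * ∏ i, a i = ∑ B : Finset (Fin k), (-1) ^ B.card * (∑ i ∈ Bᶜ, a i) ^ k)
    {f : Fin k → ℝ → ℝ} (hf : ∀ i, Continuous (f i)) (hfc : ∀ i, HasCompactSupport (f i)) :
    c * ∫ ω, labelSum (η ω) Set.univ (fun y => ∏ i, f i (y i)) ∂P =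
      ∑ B : Finset (Fin k), (-1) ^ B.card * ∫ ω, (∫ x, ∑ i ∈ Bᶜ, f i x ∂(η ω)) ^ k ∂P := by
  have hsum : ∀ B : Finset (Fin k), Continuous fun x => ∑ i ∈ Bᶜ, f i x := fun B => by fun_prop
  have hsumc : ∀ B : Finset (Fin k), HasCompactSupport fun x => ∑ i ∈ Bᶜ, f i x := fun B =>
    hasCompactSupport_finsetSum fun i _ => hfc i
  have hint : ∀ B : Finset (Fin k),
      Integrable (fun ω => (∫ x, ∑ i ∈ Bᶜ, f i x ∂(η ω)) ^ k) P := fun B =>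
    hη.integrable_integral_pow hk (hsum B) (hsumc B)
  simp only [← integral_const_mul]
  rw [← integral_finsetSum _ fun B _ => (hint B).const_mul _]
  refine integral_congr_ae ?_
  filter_upwards [hη.ae_isPointMeasure] with ω hω
  rw [hω.1.labelSum_univ_prod hω.2 hf hfc, hc]
  refine Finset.sum_congr rfl fun B _ => ?_
  rw [integral_finsetSum _ fun i _ => hω.1.integrable_of_hasCompactSupport (hf i) (hfc i)]

end IsMomentProcess

section Convergence

variable {Ω : Type*} [MeasurableSpace Ω] {P : Measure Ω} {ξ : Ω → Measure ℝ}
  {ξs : ℕ → Ω → Measure ℝ} {k : ℕ}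

theorem tendstoLabelSum_univ_prod (hξ : IsMomentProcess P ξ) (hξs : ∀ ℓ, IsMomentProcess P (ξs ℓ))
    (hk : 1 ≤ k)
    (hmom : ∀ f : ℝ → ℝ, Continuous f → HasCompactSupport f →
      Tendsto (fun ℓ => ∫ ω, (∫ x, f x ∂(ξs ℓ ω)) ^ k ∂P) atTop
        (𝓝 (∫ ω, (∫ x, f x ∂(ξ ω)) ^ k ∂P)))
    {f : Fin k → ℝ → ℝ} (hf : ∀ i, Continuous (f i)) (hfc : ∀ i, HasCompactSupport (f i)) :
    TendstoLabelSum P ξs ξ Set.univ fun y => ∏ i, f i (y i) := by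
  obtain ⟨c, hc0, hc⟩ := exists_polarization k
  have hlim := tendsto_finsetSum (Finset.univ : Finset (Finset (Fin k))) fun B _ =>
    (hmom (fun x => ∑ i ∈ Bᶜ, f i x) (by fun_prop)
      (hasCompactSupport_finsetSum fun i _ => hfc i)).const_mul ((-1 : ℝ) ^ B.card)
  simp only [← (hξs _).integral_labelSum_univ_prod hk hc hf hfc,
    ← hξ.integral_labelSum_univ_prod hk hc hf hfc] at hlim
  simpa [TendstoLabelSum, hc0] using hlim.const_mul c⁻¹

theorem tendstoLabelSum_univ_of_prod (hξ : IsMomentProcess P ξ)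
    (hξs : ∀ ℓ, IsMomentProcess P (ξs ℓ)) (hk : 1 ≤ k)
    (hprod : ∀ f : Fin k → ℝ → ℝ, (∀ i, Continuous (f i)) → (∀ i, HasCompactSupport (f i)) →
      TendstoLabelSum P ξs ξ Set.univ fun y => ∏ i, f i (y i))
    {f : (Fin k → ℝ) → ℝ} (hf : Continuous f) (hfc : HasCompactSupport f) :
    TendstoLabelSum P ξs ξ Set.univ f := by
  obtain ⟨ψ, hψ, hψc, h0, h1, hone⟩ := exists_cutoff hfc
  set M := ∫ ω, labelSum (ξ ω) Set.univ (fun y : Fin k → ℝ => ∏ i, ψ (y i)) ∂P with hM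
  have hMlim := hprod (fun _ => ψ) (fun _ => hψ) fun _ => hψc
  rw [TendstoLabelSum, ← hM] at hMlim
  refine Metric.tendsto_atTop'.2 fun δ hδ => ?_
  obtain ⟨ε, hε, hεM⟩ : ∃ ε > 0, ε * (|M| + 1) ≤ δ / 3 :=
    ⟨δ / 3 / (|M| + 1), by positivity, by field_simp; rfl⟩
  obtain ⟨p, hp⟩ := exists_mvPolynomial_near hf
    (isCompact_univ_pi fun _ : Fin k => hψc.isCompact) hε
  let F : (Fin k →₀ ℕ) → Fin k → ℝ → ℝ := fun d i x => x ^ d i * ψ x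
  have hF : ∀ d i, Continuous (F d i) := fun d i => by fun_prop
  have hFc : ∀ d i, HasCompactSupport (F d i) := fun d i => hψc.mul_left
  let G : (Fin k →₀ ℕ) → (Fin k → ℝ) → ℝ := fun d y => p.coeff d * ∏ i, F d i (y i)
  have hG : ∀ d, Continuous (G d) := fun d => by fun_prop
  have hGc : ∀ d, HasCompactSupport (G d) := fun d => (hasCompactSupport_prod (hFc d)).mul_left
  have hGsum : ∀ y, ∑ d ∈ p.support, G d y = MvPolynomial.eval y p * ∏ i, ψ (y i) := by
    intro y
    rw [MvPolynomial.eval_eq', Finset.sum_mul]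
    refine Finset.sum_congr rfl fun d _ => ?_
    simp only [G, F, Finset.prod_mul_distrib, mul_assoc]
  have hclose : ∀ y, |f y - ∑ d ∈ p.support, G d y| ≤ ε * ∏ i, ψ (y i) := by
    intro y
    have hpos : 0 ≤ ∏ i, ψ (y i) := Finset.prod_nonneg fun i _ => h0 (y i)
    have hfψ : f y = f y * ∏ i, ψ (y i) := by
      by_cases hy : f y = 0
      · simp [hy]
      · simp [hone y hy]
    rw [hGsum, hfψ, ← sub_mul, abs_mul, abs_of_nonneg hpos]
    by_cases hy : ∀ i, y i ∈ tsupport ψ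
    · exact mul_le_mul_of_nonneg_right (hp y fun i _ => hy i).le hpos
    · push Not at hy
      obtain ⟨i, hi⟩ := hy
      rw [Finset.prod_eq_zero (Finset.mem_univ i) (image_eq_zero_of_notMem_tsupport (f := ψ) hi)]
      simp
  have hconst : ∀ (μ : Measure ℝ) (c : ℝ) (g : (Fin k → ℝ) → ℝ),
      labelSum μ Set.univ (fun y => c * g y) = c * labelSum μ Set.univ g := fun μ c g => by
    simp only [labelSum, Set.indicator_univ, tsum_mul_left]
  have herr : ∀ η : Ω → Measure ℝ, IsMomentProcess P η →
      |∫ ω, labelSum (η ω) Set.univ f ∂P -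
        ∑ d ∈ p.support, ∫ ω, labelSum (η ω) Set.univ (G d) ∂P| ≤
      ε * ∫ ω, labelSum (η ω) Set.univ (fun y : Fin k → ℝ => ∏ i, ψ (y i)) ∂P := by
    intro η hη
    rw [← hη.integral_labelSum_sum hk _ _ hG hGc, ← integral_const_mul]
    simp only [← hconst]
    exact hη.abs_integral_labelSum_sub_le hk _ hf hfc (by fun_prop)
      (hasCompactSupport_finsetSum fun d _ => hGc d) (by fun_prop)
      (hasCompactSupport_prod fun _ => hψc).mul_left hclose
  have hGlim : Tendsto (fun ℓ => ∑ d ∈ p.support, ∫ ω, labelSum (ξs ℓ ω) Set.univ (G d) ∂P) atTop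
      (𝓝 (∑ d ∈ p.support, ∫ ω, labelSum (ξ ω) Set.univ (G d) ∂P)) := by
    refine tendsto_finsetSum _ fun d _ => ?_
    simp only [G, hconst, integral_const_mul]
    exact (hprod (F d) (hF d) (hFc d)).const_mul _
  have hev := (Metric.tendsto_nhds.1 hGlim (δ / 3) (by positivity)).and
    (hMlim.eventually_lt_const (show M < |M| + 1 by linarith [le_abs_self M]))
  obtain ⟨N, hN⟩ := eventually_atTop.1 hev
  refine ⟨N, fun ℓ hℓ => ?_⟩
  obtain ⟨hℓ1, hℓ2⟩ := hN ℓ hℓ.le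
  have e1 := (herr _ (hξs ℓ)).trans ((mul_le_mul_of_nonneg_left hℓ2.le hε.le).trans hεM)
  have e2 := (herr _ hξ).trans ((mul_le_mul_of_nonneg_left
    (show M ≤ |M| + 1 by linarith [le_abs_self M]) hε.le).trans hεM)
  rw [Real.dist_eq, abs_lt] at *
  rw [abs_le] at e1 e2
  constructor <;> linarith [hℓ1.1, hℓ1.2, e1.1, e1.2, e2.1, e2.2]

theorem tendstoLabelSum_ker (hk : 1 ≤ k) {f : (Fin k → ℝ) → ℝ} (hf : Continuous f)
    (hfc : HasCompactSupport f) {j : ℕ} {p : Fin k → Fin j} (hp : Function.Surjective p)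
    (hcorr : ∀ g : (Fin j → ℝ) → ℝ, 1 ≤ j → Continuous g → HasCompactSupport g →
      Tendsto (fun ℓ => ∫ ω, corrSumM (ξs ℓ ω) j g ∂P) atTop
        (𝓝 (∫ ω, corrSumM (ξ ω) j g ∂P))) :
    TendstoLabelSum P ξs ξ {m : Fin k → ℤ | Setoid.ker m = Setoid.ker p} f := by
  simp only [TendstoLabelSum, ← corrSumM_comp_surjective _ hp f]
  have hj : 1 ≤ j := (p ⟨0, hk⟩).pos
  exact hcorr _ hj (by fun_prop) (hasCompactSupport_comp_surjective hp hfc)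

theorem ConvInCorr.tendstoLabelSum_univ (h : ConvInCorr P ξs ξ) (hξ : IsMomentProcess P ξ)
    (hξs : ∀ ℓ, IsMomentProcess P (ξs ℓ)) (hk : 1 ≤ k) {f : (Fin k → ℝ) → ℝ}
    (hf : Continuous f) (hfc : HasCompactSupport f) : TendstoLabelSum P ξs ξ Set.univ f := by
  simp only [TendstoLabelSum, (hξs _).integral_labelSum_univ_eq_sum_ker hk hf hfc,
    hξ.integral_labelSum_univ_eq_sum_ker hk hf hfc]
  refine tendsto_finsetSum _ fun s _ => ?_
  obtain ⟨j, p, hp, rfl⟩ := exists_surjective_ker_eq s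
  exact tendstoLabelSum_ker hk hf hfc hp fun g hj => h j hj g

theorem convInCorr_of_tendstoLabelSum_univ (hξ : IsMomentProcess P ξ)
    (hξs : ∀ ℓ, IsMomentProcess P (ξs ℓ))
    (h : ∀ k : ℕ, 1 ≤ k → ∀ f : (Fin k → ℝ) → ℝ, Continuous f → HasCompactSupport f →
      TendstoLabelSum P ξs ξ Set.univ f) : ConvInCorr P ξs ξ := by
  classical
  intro k
  induction k using Nat.strong_induction_on with
  | _ k ih =>
    intro hk f hf hfc
    have hsplit : ∀ η : Ω → Measure ℝ, IsMomentProcess P η → ∫ ω, corrSumM (η ω) k f ∂P =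
        ∫ ω, labelSum (η ω) Set.univ f ∂P - ∑ s ∈ Finset.univ.erase (⊥ : Setoid (Fin k)),
          ∫ ω, labelSum (η ω) {m : Fin k → ℤ | Setoid.ker m = s} f ∂P := by
      intro η hη
      rw [hη.integral_labelSum_univ_eq_sum_ker hk hf hfc,
        ← Finset.add_sum_erase _ _ (Finset.mem_univ (⊥ : Setoid (Fin k)))]
      simp only [labelSum_ker_eq_bot, add_sub_cancel_right]
    simp only [hsplit _ (hξs _), hsplit _ hξ]
    refine (h k hk f hf hfc).sub (tendsto_finsetSum _ fun s hs => ?_)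
    obtain ⟨j, p, hp, rfl⟩ := exists_surjective_ker_eq s
    have hjk : j < k := by
      refine lt_of_le_of_ne (by simpa using Fintype.card_le_of_surjective p hp) fun hjk => ?_
      subst hjk
      exact Finset.ne_of_mem_erase hs
        ((Setoid.injective_iff_ker_bot p).1 (Finite.injective_iff_surjective.2 hp))
    exact tendstoLabelSum_ker hk hf hfc hp fun g hj => ih j hjk hj g

end Convergence

/-- (Prop. `correlations_moments`.) Under finiteness of all moments of counts in compact
intervals, convergence in correlation is equivalent to convergence in moments of all
linear statistics. -/
theorem stmt_4 {Ω : Type*} [MeasurableSpace Ω] (P : MeasureTheory.Measure Ω)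
    [IsProbabilityMeasure P]
    (ξ : Ω → MeasureTheory.Measure ℝ) (ξs : ℕ → Ω → MeasureTheory.Measure ℝ)
    (hmeas : Measurable ξ) (hmeass : ∀ ℓ, Measurable (ξs ℓ))
    (hpp : ∀ᵐ ω ∂P, IsPointMeasure (ξ ω) ∧ InfiniteBothDirections (ξ ω))
    (hpps : ∀ ℓ, ∀ᵐ ω ∂P, IsPointMeasure (ξs ℓ ω) ∧ InfiniteBothDirections (ξs ℓ ω))
    (hmom : ∀ k : ℕ, 1 ≤ k → ∀ a b : ℝ, ∫⁻ ω, (ξ ω (Set.Icc a b)) ^ k ∂P < ⊤)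
    (hmoms : ∀ ℓ, ∀ k : ℕ, 1 ≤ k → ∀ a b : ℝ, ∫⁻ ω, (ξs ℓ ω (Set.Icc a b)) ^ k ∂P < ⊤) :
    ConvInCorr P ξs ξ ↔
    (∀ f : ℝ → ℝ, Continuous f → HasCompactSupport f → ∀ k : ℕ, 1 ≤ k →
      Tendsto (fun ℓ => ∫ ω, (∫ x, f x ∂(ξs ℓ ω)) ^ k ∂P) atTop
        (𝓝 (∫ ω, (∫ x, f x ∂(ξ ω)) ^ k ∂P))) := by
  have hξ : IsMomentProcess P ξ := ⟨hmeas, hpp, hmom⟩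
  have hξs : ∀ ℓ, IsMomentProcess P (ξs ℓ) := fun ℓ => ⟨hmeass ℓ, hpps ℓ, hmoms ℓ⟩
  refine ⟨fun h f hf hfc k hk => ?_, fun h => ?_⟩
  · have hlim := h.tendstoLabelSum_univ hξ hξs hk (f := fun y => ∏ i, f (y i)) (by fun_prop)
      (hasCompactSupport_prod fun _ => hfc)
    simpa only [TendstoLabelSum, (hξs _).integral_labelSum_univ_pow hf hfc,
      hξ.integral_labelSum_univ_pow hf hfc] using hlim
  · exact convInCorr_of_tendstoLabelSum_univ hξ hξs fun k hk f hf hfc =>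
      tendstoLabelSum_univ_of_prod hξ hξs hk (fun g hg hgc =>
        tendstoLabelSum_univ_prod hξ hξs hk (fun f hf hfc => h f hf hfc k hk) hg hgc) hf hfc
end
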